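/- Fix integers M ≥ 1, k_L, k_R ≥ 0, let J_i = {j ∈ ℤ : i − k_L ≤ j ≤ i + k_R}, and let Δx, Δt > 0 with Δx ≤ α₀Δt. For each time level n ∈ ℕ and each i ∈ ℤ let S_iⁿ be an invertible M×M real matrix with ‖S_iⁿ‖_∞ ≤ β₀ and ‖(S_iⁿ)⁻¹‖_∞ ≤ β₋₁, let λ_i^{n,1}, …, λ_i^{n,M} ∈ ℝ, let scalars Φ_{ij}^{n,k} ∈ ℝ be given for j ∈ J_i, and set B̌_{ij}ⁿ := S_iⁿ · diag(Φ_{ij}^{n,1}, …, Φ_{ij}^{n,M}) · (S_iⁿ)⁻¹. Let B_{ij}ⁿ be M×M matrices with B_{ij}ⁿ = 0 for j ∉ J_i. Assume, with constants α₄, β₂, β₃ ≥ 0 independent of i, j, n, Δx, Δt: (i) max_k ∑_{j ∈ J_i} |Φ_{ij}^{n,k}| ≤ 1 for all i, n; (ii) ‖B_{ij}ⁿ − B̌_{ij}ⁿ‖_∞ ≤ α₄Δt for all i, n and j ∈ J_i; (iii) ‖((S_iⁿ)⁻¹ − (S_jⁿ)⁻¹)·S_jⁿ‖_∞ ≤ β₃Δx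 for all i, n and j ∈ J_i; (iv) ‖((S_i^{n+1})⁻¹ − (S_iⁿ)⁻¹)·S_iⁿ‖_∞ ≤ β₂Δt for all i, n. Define the scheme v_i^{n+1} = ∑_{j ∈ J_i} B_{ij}ⁿ·v_jⁿ and hₙ(v) := sup_i ‖(S_iⁿ)⁻¹·v_i‖_∞. Then there exists a constant γ, depending only on α₀, α₄, β₋₁, β₀, β₂, β₃, k_L, k_R, such that for every bounded initial grid function v⁰ : ℤ → ℝᴹ and every n ∈ ℕ: hₙ(vⁿ) ≤ (1 + γΔt)^{2n}·h₀(v⁰); in particular, for T = N_T·Δt one has h_{N_T}(v^{N_T}) ≤ exp(2γT)·h₀(v⁰), i.e. the scheme is stable. -/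

import Mathlib

open scoped BigOperators

attribute [local instance] Matrix.linftyOpNormedAddCommGroup

/-- Multiplication by diagonal matrices whose entries have row-wise absolute sum at most `1`
does not increase a uniform bound. -/
lemma norm_sum_diagonal_mulVec_le {m ι : Type*} [Fintype m] [DecidableEq m] (s : Finset ι)
    (d : ι → m → ℝ) (u : ι → m → ℝ) {R : ℝ} (hR : 0 ≤ R)
    (hd : ∀ k, ∑ j ∈ s, |d j k| ≤ 1) (hu : ∀ j ∈ s, ‖u j‖ ≤ R) :
    ‖∑ j ∈ s, (Matrix.diagonal (d j)).mulVec (u j)‖ ≤ R := by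
  refine (pi_norm_le_iff_of_nonneg hR).2 fun k => ?_
  rw [Finset.sum_apply]
  calc ‖∑ j ∈ s, (Matrix.diagonal (d j)).mulVec (u j) k‖
      ≤ ∑ j ∈ s, |d j k| * R := by
        refine (norm_sum_le _ _).trans (Finset.sum_le_sum fun j hj => ?_)
        rw [Matrix.mulVec_diagonal, norm_mul, Real.norm_eq_abs]
        gcongr
        exact (norm_le_pi_norm (u j) k).trans (hu j hj)
    _ = (∑ j ∈ s, |d j k|) * R := by rw [Finset.sum_mul]
    _ ≤ R := mul_le_of_le_one_left hR (hd k)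

/-- Changing the transform `Q` to `P` changes the size of the transformed vector by at most a
factor `1 + ‖(P - Q) * S‖`, where `S` is the inverse of `Q`. -/
lemma norm_mulVec_le_of_norm_sub_mul_le {m : Type*} [Fintype m] [DecidableEq m]
    {P Q S : Matrix m m ℝ} (hSQ : S * Q = 1) {ε R : ℝ} (hε : ‖(P - Q) * S‖ ≤ ε)
    {x : m → ℝ} (hx : ‖Q.mulVec x‖ ≤ R) :
    ‖P.mulVec x‖ ≤ (1 + ε) * R := by
  have hε0 : 0 ≤ ε := (norm_nonneg _).trans hε
  have h : P.mulVec x = Q.mulVec x + ((P - Q) * S).mulVec (Q.mulVec x) := by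
    rw [Matrix.mulVec_mulVec, Matrix.mul_assoc, hSQ, Matrix.mul_one, Matrix.sub_mulVec]
    abel
  calc ‖P.mulVec x‖ ≤ ‖Q.mulVec x‖ + ‖((P - Q) * S).mulVec (Q.mulVec x)‖ := by
        rw [h]; exact norm_add_le _ _
    _ ≤ R + ε * R := by
        gcongr
        exact (Matrix.linfty_opNorm_mulVec _ _).trans (by gcongr)
    _ = (1 + ε) * R := by ring

/-- One step of the scheme at a fixed point, measured in the old transform `Q = P⁻¹`. -/
lemma norm_mulVec_sum_mulVec_le {m ι : Type*} [Fintype m] [DecidableEq m] (s : Finset ι)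
    {P Q : Matrix m m ℝ} (hQP : Q * P = 1) (T Tinv B : ι → Matrix m m ℝ) (d x : ι → m → ℝ)
    (hT : ∀ j ∈ s, T j * Tinv j = 1) {a b q ε R : ℝ} (ha : 0 ≤ a) (hε : 0 ≤ ε) (hR : 0 ≤ R)
    (hq : ‖Q‖ ≤ q) (hTb : ∀ j ∈ s, ‖T j‖ ≤ b)
    (hd : ∀ k, ∑ j ∈ s, |d j k| ≤ 1)
    (hB : ∀ j ∈ s, ‖B j - P * Matrix.diagonal (d j) * Q‖ ≤ a)
    (hQ : ∀ j ∈ s, ‖(Q - Tinv j) * T j‖ ≤ ε)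
    (hx : ∀ j ∈ s, ‖(Tinv j).mulVec (x j)‖ ≤ R) :
    ‖Q.mulVec (∑ j ∈ s, (B j).mulVec (x j))‖ ≤ (1 + ε + s.card * (q * a * b)) * R := by
  have hq0 : 0 ≤ q := (norm_nonneg _).trans hq
  have key : Q.mulVec (∑ j ∈ s, (B j).mulVec (x j)) =
      ∑ j ∈ s, (Matrix.diagonal (d j)).mulVec (Q.mulVec (x j)) +
      ∑ j ∈ s, Q.mulVec ((B j - P * Matrix.diagonal (d j) * Q).mulVec (x j)) := by
    rw [Matrix.mulVec_sum, ← Finset.sum_add_distrib]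
    refine Finset.sum_congr rfl fun j _ => ?_
    have h : Q * (P * Matrix.diagonal (d j) * Q) = Matrix.diagonal (d j) * Q := by
      rw [← Matrix.mul_assoc, ← Matrix.mul_assoc, hQP, Matrix.one_mul]
    simp only [Matrix.mulVec_mulVec]
    rw [Matrix.mul_sub, h, Matrix.sub_mulVec]
    abel
  have frozen : ‖∑ j ∈ s, (Matrix.diagonal (d j)).mulVec (Q.mulVec (x j))‖ ≤ (1 + ε) * R :=
    norm_sum_diagonal_mulVec_le s d _ (by positivity) hd fun j hj =>
      norm_mulVec_le_of_norm_sub_mul_le (hT j hj) (hQ j hj) (hx j hj)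
  have error : ‖∑ j ∈ s, Q.mulVec ((B j - P * Matrix.diagonal (d j) * Q).mulVec (x j))‖ ≤
      s.card * (q * (a * (b * R))) := by
    rw [← nsmul_eq_mul]
    refine (norm_sum_le _ _).trans (Finset.sum_le_card_nsmul _ _ _ fun j hj => ?_)
    have hb0 : 0 ≤ b := (norm_nonneg _).trans (hTb j hj)
    have hxj : ‖x j‖ ≤ b * R := by
      have h : x j = (T j).mulVec ((Tinv j).mulVec (x j)) := by
        rw [Matrix.mulVec_mulVec, hT j hj, Matrix.one_mulVec]
      rw [h]
      exact (Matrix.linfty_opNorm_mulVec _ _).trans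
        (mul_le_mul (hTb j hj) (hx j hj) (norm_nonneg _) hb0)
    refine (Matrix.linfty_opNorm_mulVec _ _).trans
      (mul_le_mul hq ?_ (norm_nonneg _) hq0)
    exact (Matrix.linfty_opNorm_mulVec _ _).trans
      (mul_le_mul (hB j hj) hxj (norm_nonneg _) ha)
  rw [key]
  refine (norm_add_le _ _).trans ((add_le_add frozen error).trans_eq ?_)
  ring

/-- stability of the explicit linear scheme
`v_i^{n+1} = ∑_{j ∈ J_i} B_{ij}ⁿ·v_jⁿ` with variable diagonalizable
coefficients.  There is a constant `γ`, depending only on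
`α₀, α₄, β₋₁, β₀, β₂, β₃, k_L, k_R` (and `M`), such that whenever
`0 < Δx ≤ α₀Δt`, the similarity transforms `S_iⁿ` are uniformly bounded
(`‖S_iⁿ‖_∞ ≤ β₀`, `‖(S_iⁿ)⁻¹‖_∞ ≤ β₋₁`), the frozen-coefficient matrices
`B̌_{ij}ⁿ = S_iⁿ·diag(Φ_{ij}^{n,·})·(S_iⁿ)⁻¹` satisfy
`max_k ∑_{j∈J_i} |Φ_{ij}^{n,k}| ≤ 1`, `‖B_{ij}ⁿ − B̌_{ij}ⁿ‖_∞ ≤ α₄Δt`,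
`‖((S_iⁿ)⁻¹ − (S_jⁿ)⁻¹)·S_jⁿ‖_∞ ≤ β₃Δx` on the stencil and
`‖((S_i^{n+1})⁻¹ − (S_iⁿ)⁻¹)·S_iⁿ‖_∞ ≤ β₂Δt`, every solution with
`h₀(v⁰) ≤ C` (i.e. `‖(S_i⁰)⁻¹·v_i⁰‖_∞ ≤ C` for all `i`) satisfies
`hₙ(vⁿ) ≤ (1 + γΔt)^{2n}·C ≤ exp(2γ·nΔt)·C` for all `n`; in particular the
scheme is stable. -/
theorem stmt4 (M kL kR : ℕ) (hM : 1 ≤ M)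
    (α₀ α₄ βm1 β₀ β₂ β₃ : ℝ)
    (hα₀ : 0 ≤ α₀) (hα₄ : 0 ≤ α₄) (hβm1 : 0 ≤ βm1) (hβ₀ : 0 ≤ β₀)
    (hβ₂ : 0 ≤ β₂) (hβ₃ : 0 ≤ β₃) :
    ∃ γ : ℝ, 0 ≤ γ ∧
      ∀ (Δx Δt : ℝ), 0 < Δx → 0 < Δt → Δx ≤ α₀ * Δt →
      ∀ (S Sinv : ℕ → ℤ → Matrix (Fin M) (Fin M) ℝ)
        (Φ : ℕ → ℤ → ℤ → Fin M → ℝ)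
        (B : ℕ → ℤ → ℤ → Matrix (Fin M) (Fin M) ℝ),
      (∀ n i, S n i * Sinv n i = 1 ∧ Sinv n i * S n i = 1) →
      (∀ n i, ‖S n i‖ ≤ β₀) →
      (∀ n i, ‖Sinv n i‖ ≤ βm1) →
      (∀ (n : ℕ) (i j : ℤ), j ∉ Finset.Icc (i - (kL : ℤ)) (i + (kR : ℤ)) →
        B n i j = 0) →
      (∀ (n : ℕ) (i : ℤ) (k : Fin M),
        ∑ j ∈ Finset.Icc (i - (kL : ℤ)) (i + (kR : ℤ)), |Φ n i j k| ≤ 1) →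
      (∀ (n : ℕ) (i j : ℤ), j ∈ Finset.Icc (i - (kL : ℤ)) (i + (kR : ℤ)) →
        ‖B n i j - S n i * Matrix.diagonal (Φ n i j) * Sinv n i‖ ≤ α₄ * Δt) →
      (∀ (n : ℕ) (i j : ℤ), j ∈ Finset.Icc (i - (kL : ℤ)) (i + (kR : ℤ)) →
        ‖(Sinv n i - Sinv n j) * S n j‖ ≤ β₃ * Δx) →
      (∀ (n : ℕ) (i : ℤ), ‖(Sinv (n + 1) i - Sinv n i) * S n i‖ ≤ β₂ * Δt) →
      ∀ (v : ℕ → ℤ → Fin M → ℝ),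
      (∀ (n : ℕ) (i : ℤ), v (n + 1) i =
        ∑ j ∈ Finset.Icc (i - (kL : ℤ)) (i + (kR : ℤ)), (B n i j).mulVec (v n j)) →
      ∀ C : ℝ, (∀ i : ℤ, ‖(Sinv 0 i).mulVec (v 0 i)‖ ≤ C) →
      ∀ (n : ℕ) (i : ℤ),
        ‖(Sinv n i).mulVec (v n i)‖ ≤ (1 + γ * Δt) ^ (2 * n) * C ∧
        ‖(Sinv n i).mulVec (v n i)‖ ≤ Real.exp (2 * γ * (n * Δt)) * C := by
  set K : ℝ := kL + kR + 1 with hK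
  have hK0 : 0 ≤ K := by positivity
  have hcard : ∀ i : ℤ, ((Finset.Icc (i - (kL : ℤ)) (i + (kR : ℤ))).card : ℝ) = K := by
    intro i
    have h : (Finset.Icc (i - (kL : ℤ)) (i + (kR : ℤ))).card = kL + kR + 1 := by
      rw [Int.card_Icc]; omega
    rw [h, hK]; push_cast; ring
  set γ : ℝ := β₃ * α₀ + K * (βm1 * α₄ * β₀) + β₂ with hγ
  have hγ0 : 0 ≤ γ := by positivity
  refine ⟨γ, hγ0, ?_⟩
  intro Δx Δt hΔx hΔt hΔ S Sinv Φ B hS hSb hSinvb _ hΦ hB hSx hSt v hv C hC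
  have hC0 : 0 ≤ C := (norm_nonneg _).trans (hC 0)
  have hβ₂γ : β₂ ≤ γ := le_add_of_nonneg_left (by positivity)
  have bound : ∀ (n : ℕ) (i : ℤ),
      ‖(Sinv n i).mulVec (v n i)‖ ≤ (1 + γ * Δt) ^ (2 * n) * C := by
    intro n
    induction n with
    | zero => simpa using hC
    | succ n ih =>
      intro i
      set R := (1 + γ * Δt) ^ (2 * n) * C with hR
      have hR0 : 0 ≤ R := by positivity
      have old : ‖(Sinv n i).mulVec (v (n + 1) i)‖ ≤ (1 + γ * Δt) * R := by
        rw [hv n i]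
        refine (norm_mulVec_sum_mulVec_le _ (hS n i).2 (S n) (Sinv n) (B n i) (Φ n i) (v n)
          (fun j _ => (hS n j).1) (a := α₄ * Δt) (b := β₀) (q := βm1) (ε := β₃ * Δx)
          (by positivity) (by positivity) hR0 (hSinvb n i) (fun j _ => hSb n j) (hΦ n i)
          (hB n i) (hSx n i) (fun j _ => ih j)).trans ?_
        rw [hcard i]
        refine mul_le_mul_of_nonneg_right ?_ hR0
        have h₁ : β₃ * Δx ≤ β₃ * (α₀ * Δt) := by gcongr
        have h₂ : 0 ≤ β₂ * Δt := by positivity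
        rw [hγ]
        linarith
      calc ‖(Sinv (n + 1) i).mulVec (v (n + 1) i)‖
          ≤ (1 + β₂ * Δt) * ((1 + γ * Δt) * R) :=
            norm_mulVec_le_of_norm_sub_mul_le (hS n i).1 (hSt n i) old
        _ ≤ (1 + γ * Δt) * ((1 + γ * Δt) * R) := by gcongr
        _ = (1 + γ * Δt) ^ (2 * (n + 1)) * C := by rw [hR]; ring
  intro n i
  refine ⟨bound n i, (bound n i).trans ?_⟩
  gcongr
  calc (1 + γ * Δt) ^ (2 * n) ≤ Real.exp (γ * Δt) ^ (2 * n) := by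
        gcongr
        rw [add_comm]
        exact Real.add_one_le_exp _
    _ = Real.exp (2 * γ * (n * Δt)) := by
        rw [← Real.exp_nat_mul]
        push_cast
        ring_nf
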